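/- arXiv:2008.11581 — 2 statements merged into one kernel-verified Lean document; each statement's English description precedes it below -/
import Mathlib

section
/- Let P be a Markov kernel on a measurable space (E, 𝓔), let μ be an invariant probability measure of P, let f : E → ℝ be bounded and measurable, and let γ ∈ ℝ. Define ψ_γ(x) = ℙ_x( liminf_{n→∞} (1/n) ∑_{i=0}^{n−1} f(X_i) ≥ γ ), where ℙ_x is the law on E^{ℕ₀} of the Markov chain (X_i) with kernel P started at x. Then ψ_γ(x) ∈ {0, 1} for μ-almost all x ∈ E. -/
open MeasureTheory ProbabilityTheory Filter

/-- `μ` is an invariant probability measure of the Markov kernel `P`. -/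
def IsInvariantMeasure {E : Type*} [MeasurableSpace E] (P : Kernel E E)
    (μ : Measure E) : Prop :=
  ∀ A : Set E, MeasurableSet A → μ A = ∫⁻ x, P x A ∂μ

/-- Prepend a point to a trajectory. -/
def consTraj {E : Type*} (x : E) (ω : ℕ → E) : ℕ → E :=
  fun n => Nat.casesOn n x ω

/-- `ℙP : E → Measure (ℕ → E)` is the family of laws of the Markov chain with
kernel `P`: `ℙP x` is a probability measure, and it is the law of the chain
started at `x`, i.e. it satisfies the defining recursion
`ℙP x = ∫ (law of x prepended to a ℙP y-trajectory) P(x,dy)`. -/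
def IsChainLaw {E : Type*} [MeasurableSpace E] (P : Kernel E E)
    (ℙP : E → Measure (ℕ → E)) : Prop :=
  (∀ x, IsProbabilityMeasure (ℙP x)) ∧
    ∀ x, ℙP x = (P x).bind (fun y => (ℙP y).map (consTraj x))


namespace PsiAux

variable {E : Type*} [MeasurableSpace E]

lemma measurable_cons (x : E) : Measurable (consTraj x) := by
  refine measurable_pi_lambda _ fun n => ?_
  cases n with
  | zero => exact measurable_const
  | succ n => exact measurable_pi_apply n

/-- Finite-dimensional cylinders. -/
def cyl (n : ℕ) (B : ℕ → Set E) : Set (ℕ → E) := {ω | ∀ i < n, ω i ∈ B i}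

/-- The family of measurable finite-dimensional cylinders. -/
def cyls (E : Type*) [MeasurableSpace E] : Set (Set (ℕ → E)) :=
  {C | ∃ n B, (∀ i, MeasurableSet (B i)) ∧ C = cyl n B}

lemma measurableSet_cyl (n : ℕ) (B : ℕ → Set E) (hB : ∀ i, MeasurableSet (B i)) :
    MeasurableSet (cyl n B) := by
  have : cyl n B = ⋂ i, ⋂ (_ : i < n), (fun ω : ℕ → E => ω i) ⁻¹' B i := by
    ext ω; simp [cyl]
  rw [this]
  exact MeasurableSet.iInter fun i => MeasurableSet.iInter fun _ => measurable_pi_apply i (hB i)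

lemma isPiSystem_cyls : IsPiSystem (cyls E) := by
  rintro _ ⟨n, B, hB, rfl⟩ _ ⟨m, B', hB', rfl⟩ -
  classical
  refine ⟨max n m, fun i => (if i < n then B i else Set.univ) ∩ (if i < m then B' i else Set.univ),
    fun i => ?_, ?_⟩
  · refine MeasurableSet.inter ?_ ?_ <;> split_ifs <;> simp [hB, hB']
  · ext ω
    simp only [cyl, Set.mem_inter_iff, Set.mem_ofPred_eq]
    constructor
    · rintro ⟨h1, h2⟩ i -
      constructor <;> split_ifs with h <;> simp_all
    · intro h
      refine ⟨fun i hi => ?_, fun i hi => ?_⟩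
      · have := (h i (lt_max_of_lt_left hi)).1
        rwa [if_pos hi] at this
      · have := (h i (lt_max_of_lt_right hi)).2
        rwa [if_pos hi] at this

lemma pi_eq_generateFrom :
    (MeasurableSpace.pi : MeasurableSpace (ℕ → E)) = MeasurableSpace.generateFrom (cyls E) := by
  classical
  apply le_antisymm
  · rw [MeasurableSpace.pi_eq_generateFrom_projections]
    refine MeasurableSpace.generateFrom_le ?_
    rintro _ ⟨i, A, hA, rfl⟩
    refine MeasurableSpace.measurableSet_generateFrom
      ⟨i + 1, fun j => if j = i then A else Set.univ, fun j => ?_, ?_⟩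
    · by_cases h : j = i <;> simp [hA, h]
    · ext ω
      simp only [cyl, Set.mem_preimage, Function.eval, Set.mem_ofPred_eq]
      constructor
      · intro h j _
        split_ifs with hj
        · rwa [hj]
        · trivial
      · intro h
        simpa using h i (Nat.lt_succ_self i)
  · refine MeasurableSpace.generateFrom_le ?_
    rintro _ ⟨n, B, hB, rfl⟩
    exact measurableSet_cyl n B hB

variable {P : Kernel E E} {Q : E → Measure (ℕ → E)}

lemma aemeas (hQ : IsChainLaw P Q) (x : E) :
    AEMeasurable (fun y => (Q y).map (consTraj x)) (P x) := by
  by_contra h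
  have h2 := hQ.2 x
  rw [Measure.bind, Measure.map_of_not_aemeasurable h, Measure.join_zero] at h2
  have := hQ.1 x
  exact IsProbabilityMeasure.ne_zero (Q x) h2

lemma apply_eq (hQ : IsChainLaw P Q) (x : E) {D : Set (ℕ → E)} (hD : MeasurableSet D) :
    Q x D = ∫⁻ y, Q y (consTraj x ⁻¹' D) ∂P x := by
  conv_lhs => rw [hQ.2 x]
  rw [Measure.bind_apply hD (aemeas hQ x)]
  refine lintegral_congr fun y => ?_
  rw [Measure.map_apply (measurable_cons x) hD]

lemma cons_preimage_cyl_of_mem (n : ℕ) (B : ℕ → Set E) {x : E} (hx : x ∈ B 0) :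
    consTraj x ⁻¹' cyl (n + 1) B = cyl n (fun i => B (i + 1)) := by
  ext ω
  simp only [cyl, Set.mem_preimage, Set.mem_ofPred_eq]
  constructor
  · intro h i hi
    exact h (i + 1) (by omega)
  · intro h i hi
    cases i with
    | zero => exact hx
    | succ i => exact h i (by omega)

lemma cons_preimage_cyl_of_notMem (n : ℕ) (B : ℕ → Set E) {x : E} (hx : x ∉ B 0) :
    consTraj x ⁻¹' cyl (n + 1) B = ∅ := by
  ext ω
  simp only [cyl, Set.mem_preimage, Set.mem_ofPred_eq, Set.mem_empty_iff_false, iff_false]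
  intro h
  exact hx (h 0 (by omega))

lemma meas_cyl (hQ : IsChainLaw P Q) (n : ℕ) : ∀ (B : ℕ → Set E), (∀ i, MeasurableSet (B i)) →
    Measurable fun x => Q x (cyl n B) := by
  classical
  induction n with
  | zero =>
    intro B _
    have h1 : ∀ x, Q x (cyl 0 B) = 1 := fun x => by
      have := hQ.1 x
      simp [cyl]
    simp only [h1]
    exact measurable_const
  | succ n ih =>
    intro B hB
    have h1 : (fun x => Q x (cyl (n + 1) B)) =
        (B 0).indicator fun x => ∫⁻ y, Q y (cyl n (fun i => B (i + 1))) ∂P x := by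
      ext x
      rw [apply_eq hQ x (measurableSet_cyl _ B hB)]
      by_cases hx : x ∈ B 0
      · simp [hx, cons_preimage_cyl_of_mem n B hx]
      · simp [hx, cons_preimage_cyl_of_notMem n B hx]
    rw [h1]
    exact Measurable.indicator (Measurable.lintegral_kernel (ih _ fun i => hB (i + 1))) (hB 0)

lemma meas (hQ : IsChainLaw P Q) : Measurable Q := by
  have := hQ.1
  refine Measurable.measure_of_isPiSystem_of_isProbabilityMeasure pi_eq_generateFrom
    isPiSystem_cyls ?_
  rintro _ ⟨n, B, hB, rfl⟩
  exact meas_cyl hQ n B hB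

lemma invariant_bind {μ : Measure E} (hμ : IsInvariantMeasure P μ) : μ.bind P = μ := by
  ext A hA
  rw [Measure.bind_apply hA P.aemeasurable, hμ A hA]

lemma harmonic_const [IsMarkovKernel P] {μ : Measure E} [IsProbabilityMeasure μ]
    (hμ : IsInvariantMeasure P μ) (ψ : E → ENNReal) (hm : Measurable ψ) (h1 : ∀ x, ψ x ≤ 1)
    (hh : ∀ x, ψ x = ∫⁻ y, ψ y ∂P x) : ∀ᵐ x ∂μ, ∀ᵐ y ∂P x, ψ y = ψ x := by
  set g : E → ℝ := fun x => (ψ x).toReal with hg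
  have hgm : Measurable g := hm.ennreal_toReal
  have hfin : ∀ x, ψ x ≠ ⊤ := fun x => ne_top_of_le_ne_top ENNReal.one_ne_top (h1 x)
  have hg0 : ∀ x, 0 ≤ g x := fun x => ENNReal.toReal_nonneg
  have hg1 : ∀ x, g x ≤ 1 := fun x => by
    simpa using ENNReal.toReal_mono ENNReal.one_ne_top (h1 x)
  have hgi : ∀ x, Integrable g (P x) := fun x =>
    Integrable.of_bound hgm.aestronglyMeasurable 1
      (Eventually.of_forall fun y => by rw [Real.norm_of_nonneg (hg0 y)]; exact hg1 y)
  have hg2i : ∀ x, Integrable (fun y => g y ^ 2) (P x) := fun x =>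
    Integrable.of_bound (hgm.pow_const 2).aestronglyMeasurable 1
      (Eventually.of_forall fun y => by
        rw [Real.norm_of_nonneg (sq_nonneg _)]; exact pow_le_one₀ (hg0 y) (hg1 y))
  have hint : ∀ x, ∫ y, g y ∂P x = g x := fun x => by
    rw [integral_toReal hm.aemeasurable (Eventually.of_forall fun y => (hfin y).lt_top), ← hh x]
  have hq : ∀ x, ∫ y, (g y - g x) ^ 2 ∂P x = ∫ y, g y ^ 2 ∂P x - g x ^ 2 := fun x => by
    have e : ∀ y, (g y - g x) ^ 2 = g y ^ 2 - (2 * g x) * g y + g x ^ 2 := fun y => by ring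
    simp only [e]
    have hi : Integrable (fun y => g y ^ 2 - (2 * g x) * g y) (P x) :=
      (hg2i x).sub ((hgi x).const_mul _)
    rw [integral_add hi (integrable_const _),
      integral_sub (hg2i x) ((hgi x).const_mul _), integral_const_mul, hint x]
    simp
    ring
  have hqi : ∀ x, Integrable (fun y => (g y - g x) ^ 2) (P x) := fun x => by
    have e : (fun y => (g y - g x) ^ 2) = fun y => g y ^ 2 - (2 * g x) * g y + g x ^ 2 := by
      ext y; ring
    rw [e]
    exact ((hg2i x).sub ((hgi x).const_mul _)).add (integrable_const _)
  set G : E → ENNReal := fun x => ENNReal.ofReal (g x ^ 2) with hG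
  have hGm : Measurable G := (hgm.pow_const 2).ennreal_ofReal
  set D : E → ENNReal := fun x => ∫⁻ y, ENNReal.ofReal ((g y - g x) ^ 2) ∂P x with hD
  have hDm : Measurable D := by
    refine Measurable.lintegral_kernel_prod_right (f := fun x y => ENNReal.ofReal ((g y - g x) ^ 2)) ?_
    exact ((((hgm.comp measurable_snd).sub (hgm.comp measurable_fst))).pow_const 2).ennreal_ofReal
  have key : ∀ x, G x + D x = ∫⁻ y, G y ∂P x := fun x => by
    rw [hD, hG]
    simp only
    rw [← ofReal_integral_eq_lintegral_ofReal (hqi x) (Eventually.of_forall fun y => sq_nonneg _),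
      ← ofReal_integral_eq_lintegral_ofReal (hg2i x) (Eventually.of_forall fun y => sq_nonneg _),
      ← ENNReal.ofReal_add (sq_nonneg _) (integral_nonneg fun y => sq_nonneg _), hq x]
    congr 1; ring
  have hGfin : ∫⁻ x, G x ∂μ ≠ ⊤ := by
    refine ne_top_of_le_ne_top ENNReal.one_ne_top ?_
    calc ∫⁻ x, G x ∂μ ≤ ∫⁻ x, 1 ∂μ := lintegral_mono fun x => by
          simp only [hG]
          exact ENNReal.ofReal_le_one.2 (pow_le_one₀ (hg0 x) (hg1 x))
      _ = 1 := by simp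
  have hsum : ∫⁻ x, G x ∂μ + ∫⁻ x, D x ∂μ = ∫⁻ x, G x ∂μ := by
    rw [← lintegral_add_left hGm, lintegral_congr key,
      ← Measure.lintegral_bind P.aemeasurable hGm.aemeasurable, invariant_bind hμ]
  have hD0 : ∫⁻ x, D x ∂μ = 0 := by
    have : ∫⁻ x, G x ∂μ + ∫⁻ x, D x ∂μ = ∫⁻ x, G x ∂μ + 0 := by rw [hsum, add_zero]
    exact (ENNReal.add_right_inj hGfin).1 this
  rw [lintegral_eq_zero_iff hDm] at hD0
  filter_upwards [hD0] with x hx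
  simp only [hD, Pi.zero_apply] at hx
  have hmx : Measurable fun y => ENNReal.ofReal ((g y - g x) ^ 2) :=
    ((hgm.sub measurable_const).pow_const 2).ennreal_ofReal
  rw [lintegral_eq_zero_iff hmx] at hx
  filter_upwards [hx] with y hy
  simp only [Pi.zero_apply, ENNReal.ofReal_eq_zero] at hy
  have h0 : g y - g x = 0 := by
    have := le_antisymm hy (sq_nonneg _)
    simpa using this
  exact (ENNReal.toReal_eq_toReal_iff' (hfin y) (hfin x)).1 (sub_eq_zero.1 h0)

lemma zero_one [IsMarkovKernel P] {μ : Measure E} [IsProbabilityMeasure μ]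
    (hμ : IsInvariantMeasure P μ) (hQ : IsChainLaw P Q) (A : Set (ℕ → E)) (hA : MeasurableSet A)
    (hinv : ∀ x, consTraj x ⁻¹' A = A) : ∀ᵐ x ∂μ, Q x A = 0 ∨ Q x A = 1 := by
  have := hQ.1
  have hψm : Measurable fun x => Q x A := (Measure.measurable_coe hA).comp (meas hQ)
  have hc := harmonic_const hμ (fun x => Q x A) hψm (fun x => prob_le_one) (fun x => by
    conv_lhs => rw [apply_eq hQ x hA, hinv x])
  have main : ∀ C, MeasurableSet C → ∀ᵐ x ∂μ, Q x (A ∩ C) = Q x A * Q x C := by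
    intro C hC
    induction C, hC using MeasurableSpace.induction_on_inter pi_eq_generateFrom isPiSystem_cyls with
    | empty => simp
    | basic C hC =>
      obtain ⟨n, B, hB, rfl⟩ := hC
      induction n generalizing B with
      | zero => simp [cyl]
      | succ n ih =>
        have h2 := ih (fun i => B (i + 1)) (fun i => hB (i + 1))
        have h3 : ∀ᵐ x ∂μ, ∀ᵐ y ∂P x, Q y (A ∩ cyl n (fun i => B (i + 1))) =
            Q y A * Q y (cyl n (fun i => B (i + 1))) := by
          refine Measure.ae_ae_of_ae_bind P.aemeasurable ?_
          rwa [invariant_bind hμ]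
        filter_upwards [hc, h3] with x hx hx3
        rw [apply_eq hQ x (hA.inter (measurableSet_cyl _ B hB)),
          apply_eq hQ x (measurableSet_cyl _ B hB), Set.preimage_inter, hinv]
        by_cases hxB : x ∈ B 0
        · rw [cons_preimage_cyl_of_mem n B hxB,
            ← lintegral_const_mul _ (meas_cyl hQ n _ fun i => hB (i + 1))]
          refine lintegral_congr_ae ?_
          filter_upwards [hx, hx3] with y hy hy3
          rw [hy3, hy]
        · simp [cons_preimage_cyl_of_notMem n B hxB]
    | compl C hC ih =>
      filter_upwards [ih] with x hx
      rw [← Set.diff_eq, ← Set.diff_inter_self_eq_diff, Set.inter_comm C A,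
        measure_diff Set.inter_subset_left (hA.inter hC).nullMeasurableSet (measure_ne_top _ _), hx,
        prob_compl_eq_one_sub hC, ENNReal.mul_sub (fun _ _ => measure_ne_top _ _), mul_one]
    | iUnion f hd hf ih =>
      filter_upwards [ae_all_iff.2 ih] with x hx
      rw [Set.inter_iUnion, measure_iUnion _ (fun i => hA.inter (hf i)), measure_iUnion hd hf,
        ← ENNReal.tsum_mul_left]
      · exact tsum_congr hx
      · intro i j hij
        exact (hd hij).mono Set.inter_subset_right Set.inter_subset_right
  filter_upwards [main A hA] with x hx
  rw [Set.inter_self] at hx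
  by_cases h0 : Q x A = 0
  · exact Or.inl h0
  · right
    have h : Q x A * 1 = Q x A * Q x A := by rw [mul_one]; exact hx
    exact ((ENNReal.mul_right_inj h0 (measure_ne_top _ _)).1 h).symm

lemma le_liminf_of_close {u v : ℕ → ℝ} {C γ : ℝ} (hu : ∀ n, |u n| ≤ C) (hv : ∀ n, |v n| ≤ C)
    (huv : Tendsto (fun n => u n - v n) atTop (nhds 0)) (h : γ ≤ liminf u atTop) :
    γ ≤ liminf v atTop := by
  have cob : ∀ w : ℕ → ℝ, (∀ n, |w n| ≤ C) → IsCoboundedUnder (· ≥ ·) atTop w := fun w hw =>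
    IsBoundedUnder.isCoboundedUnder_ge ⟨C, by
      simpa using ⟨0, fun n _ => (abs_le.1 (hw n)).2⟩⟩
  have bd : ∀ w : ℕ → ℝ, (∀ n, |w n| ≤ C) → IsBoundedUnder (· ≥ ·) atTop w := fun w hw =>
    ⟨-C, by simpa using ⟨0, fun n _ => (abs_le.1 (hw n)).1⟩⟩
  rw [le_liminf_iff (cob u hu) (bd u hu)] at h
  rw [le_liminf_iff (cob v hv) (bd v hv)]
  intro y hy
  have h1 := h ((y + γ) / 2) (by linarith)
  have h2 := huv.eventually (gt_mem_nhds (show (0 : ℝ) < (γ - y) / 2 by linarith))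
  filter_upwards [h1, h2] with n h1 h2
  linarith

lemma avg_bound {a : ℕ → ℝ} {C : ℝ} (ha : ∀ n, |a n| ≤ C) (n : ℕ) :
    |(∑ i ∈ Finset.range n, a i) / n| ≤ C := by
  have hC : 0 ≤ C := (abs_nonneg _).trans (ha 0)
  rw [abs_div, Nat.abs_cast]
  refine div_le_of_le_mul₀ (Nat.cast_nonneg n) hC ?_
  calc |∑ i ∈ Finset.range n, a i| ≤ ∑ i ∈ Finset.range n, |a i| := Finset.abs_sum_le_sum_abs _ _
    _ ≤ ∑ i ∈ Finset.range n, C := Finset.sum_le_sum fun i _ => ha i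
    _ = C * n := by simp [mul_comm]

lemma avg_close (f : E → ℝ) {C : ℝ} (hC : ∀ x, |f x| ≤ C) (x : E) (ω : ℕ → E) :
    Tendsto (fun n : ℕ => (∑ i ∈ Finset.range n, f (consTraj x ω i)) / n -
      (∑ i ∈ Finset.range n, f (ω i)) / n) atTop (nhds 0) := by
  have hlim : Tendsto (fun n : ℕ => (2 * C) / (n : ℝ)) atTop (nhds 0) :=
    tendsto_const_div_atTop_nhds_zero_nat _
  refine squeeze_zero_norm (fun n => ?_) hlim
  rw [Real.norm_eq_abs, ← sub_div, abs_div, Nat.abs_cast]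
  refine div_le_div_of_nonneg_right ?_ (Nat.cast_nonneg n)
  have hC0 : 0 ≤ C := (abs_nonneg _).trans (hC x)
  cases n with
  | zero => simpa using hC0
  | succ n =>
    rw [Finset.sum_range_succ', Finset.sum_range_succ]
    have e : ∑ i ∈ Finset.range n, f (consTraj x ω (i + 1)) = ∑ i ∈ Finset.range n, f (ω i) := rfl
    have e0 : f (consTraj x ω 0) = f x := rfl
    rw [e, e0]
    have h1 := abs_le.1 (hC x)
    have h2 := abs_le.1 (hC (ω n))
    rw [abs_le]
    constructor <;> linarith

end PsiAux

/-- Proposition `psi`, first part: for an invariant probability measure `μ` of a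
Markov kernel `P`, a bounded measurable `f : E → ℝ` and `γ ∈ ℝ`,
`ψ_γ(x) = ℙ_x(liminf (1/n) ∑_{i<n} f(X_i) ≥ γ)` takes only the values `0` and
`1` for μ-almost all `x`. -/
theorem psi_gamma_ae_zero_or_one
    {E : Type*} [MeasurableSpace E] (P : Kernel E E) [IsMarkovKernel P]
    (μ : Measure E) [IsProbabilityMeasure μ] (hμ : IsInvariantMeasure P μ)
    (ℙP : E → Measure (ℕ → E)) (hℙ : IsChainLaw P ℙP)
    (f : E → ℝ) (hf : Measurable f) (hbdd : ∃ Cf : ℝ, ∀ x, |f x| ≤ Cf)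
    (γ : ℝ)
    (ψ : E → ENNReal)
    (hψ : ∀ x, ψ x = ℙP x {ω : ℕ → E |
      γ ≤ liminf (fun n : ℕ => (∑ i ∈ Finset.range n, f (ω i)) / n) atTop}) :
    ∀ᵐ x ∂μ, ψ x = 0 ∨ ψ x = 1 := by
  obtain ⟨C, hC⟩ := hbdd
  simp only [hψ]
  refine PsiAux.zero_one hμ hℙ _ ?_ ?_
  · refine measurableSet_le measurable_const (Measurable.liminf fun n => ?_)
    exact (Finset.measurable_sum _ fun i _ => hf.comp (measurable_pi_apply i)).div_const _
  · intro x
    ext ω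
    simp only [Set.mem_preimage, Set.mem_ofPred_eq]
    have hcl := PsiAux.avg_close f hC x ω
    constructor
    · exact PsiAux.le_liminf_of_close (PsiAux.avg_bound fun n => hC _)
        (PsiAux.avg_bound fun n => hC _) hcl
    · refine PsiAux.le_liminf_of_close (PsiAux.avg_bound fun n => hC _)
        (PsiAux.avg_bound fun n => hC _) ?_
      simpa using hcl.neg
end

section
/- Let P be a Markov kernel on a measurable space (E, 𝓔), let μ be an invariant probability measure of P, and let f : E → [0, 1] be measurable. Set m := ∫ f dμ and let γ ∈ [0, m] with γ < 1. Define ψ_γ(x) = ℙ_x( liminf_{n→∞} (1/n) ∑_{i=0}^{n−1} f(X_i) ≥ γ ). Then μ({x ∈ E : ψ_γ(x) = 1}) ≥ 1 − (1 − m)/(1 − γ). -/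
open MeasureTheory ProbabilityTheory Filter

section Aux

set_option linter.unusedSectionVars false

open scoped ENNReal Topology

/-- The left shift on trajectories. -/
def shiftTraj {E : Type*} (ω : ℕ → E) : ℕ → E := fun n => ω (n + 1)

/-- A box depending on the first `n` coordinates. -/
def boxSet {E : Type*} (n : ℕ) (t : ℕ → Set E) : Set (ℕ → E) := {ω | ∀ i < n, ω i ∈ t i}

variable {E : Type*} [MeasurableSpace E]

lemma measurable_consTraj (x : E) : Measurable (consTraj x : (ℕ → E) → ℕ → E) := by
  refine measurable_pi_lambda _ fun n => ?_
  cases n with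
  | zero => exact measurable_const
  | succ k => exact measurable_pi_apply k

lemma measurable_shiftTraj : Measurable (shiftTraj : (ℕ → E) → ℕ → E) :=
  measurable_pi_lambda _ fun n => measurable_pi_apply (n + 1)

lemma shift_cons (x : E) (ω : ℕ → E) : shiftTraj (consTraj x ω) = ω := rfl

lemma measurableSet_boxSet (n : ℕ) (t : ℕ → Set E) (ht : ∀ i, MeasurableSet (t i)) :
    MeasurableSet (boxSet n t) := by
  have : boxSet n t = ⋂ i, ⋂ (_ : i < n), (fun ω : ℕ → E => ω i) ⁻¹' t i := by
    ext ω; simp [boxSet]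
  rw [this]
  exact MeasurableSet.iInter fun i => MeasurableSet.iInter fun _ => measurable_pi_apply i (ht i)

lemma cons_preimage_boxSet (x : E) (n : ℕ) (t : ℕ → Set E) :
    consTraj x ⁻¹' boxSet (n + 1) t = {ω | x ∈ t 0 ∧ ω ∈ boxSet n (fun i => t (i + 1))} := by
  ext ω
  constructor
  · intro h
    exact ⟨h 0 (Nat.succ_pos n), fun i hi => h (i + 1) (by omega)⟩
  · rintro ⟨h0, h⟩ i hi
    cases i with
    | zero => exact h0
    | succ k => exact h k (by omega)

lemma squareCyl_eq_box {S : Set (ℕ → E)}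
    (hS : S ∈ squareCylinders (fun _ : ℕ => {s : Set E | MeasurableSet s})) :
    ∃ n t, (∀ i, MeasurableSet (t i)) ∧ S = boxSet n t := by
  classical
  obtain ⟨s, t, ht, rfl⟩ := hS
  refine ⟨s.sup id + 1, fun i => if i ∈ s then t i else Set.univ, fun i => ?_, ?_⟩
  · dsimp only
    split_ifs
    · exact ht i (Set.mem_univ i)
    · exact MeasurableSet.univ
  · ext ω
    constructor
    · intro h i _
      by_cases his : i ∈ s
      · simpa [his] using h i his
      · simp [his]
    · intro h i his
      have h1 : i ≤ s.sup id := Finset.le_sup (f := id) his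
      have his' : i ∈ s := his
      have := h i (by omega)
      simpa [his'] using this

lemma isPi_sq : IsPiSystem (squareCylinders (fun _ : ℕ => {s : Set E | MeasurableSet s})) :=
  isPiSystem_squareCylinders (fun _ => MeasurableSpace.isPiSystem_measurableSet)
    (fun _ => MeasurableSet.univ)

variable {P : Kernel E E} {ℙP : E → Measure (ℕ → E)}

lemma chain_aemeas (hℙ : IsChainLaw P ℙP) (x : E) :
    AEMeasurable (fun y => (ℙP y).map (consTraj x)) (P x) := by
  by_contra h
  have h1 := hℙ.2 x
  rw [Measure.bind, Measure.map_of_not_aemeasurable h, Measure.join_zero] at h1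
  have := hℙ.1 x
  exact IsProbabilityMeasure.ne_zero (ℙP x) h1

lemma chain_apply (hℙ : IsChainLaw P ℙP) (x : E) {C : Set (ℕ → E)} (hC : MeasurableSet C) :
    ℙP x C = ∫⁻ y, ℙP y (consTraj x ⁻¹' C) ∂(P x) := by
  conv_lhs => rw [hℙ.2 x]
  rw [Measure.bind_apply hC (chain_aemeas hℙ x)]
  exact lintegral_congr fun y => Measure.map_apply (measurable_consTraj x) hC

lemma chain_box (hℙ : IsChainLaw P ℙP) (x : E) {n : ℕ} {t : ℕ → Set E}
    (ht : ∀ i, MeasurableSet (t i)) :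
    ℙP x (boxSet (n + 1) t) =
      (t 0).indicator (fun x => ∫⁻ y, ℙP y (boxSet n (fun i => t (i + 1))) ∂(P x)) x := by
  rw [chain_apply hℙ x (measurableSet_boxSet _ _ ht), cons_preimage_boxSet]
  by_cases hx : x ∈ t 0 <;> simp [hx]

lemma measurable_chain [IsMarkovKernel P] (hℙ : IsChainLaw P ℙP) : Measurable ℙP := by
  have := hℙ.1
  refine Measurable.measure_of_isPiSystem_of_isProbabilityMeasure
    generateFrom_squareCylinders.symm isPi_sq ?_
  intro S hS
  obtain ⟨n, t, ht, rfl⟩ := squareCyl_eq_box hS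
  clear hS
  induction n generalizing t with
  | zero =>
    have : boxSet 0 t = Set.univ := by ext; simp [boxSet]
    simp [this]
  | succ n ih =>
    simp_rw [chain_box hℙ _ ht]
    exact (Measurable.lintegral_kernel (ih _ fun i => ht (i + 1))).indicator (ht 0)

lemma chain_shift (hℙ : IsChainLaw P ℙP) (x : E) {C : Set (ℕ → E)} (hC : MeasurableSet C) :
    ℙP x (shiftTraj ⁻¹' C) = ∫⁻ y, ℙP y C ∂(P x) := by
  rw [chain_apply hℙ x (measurable_shiftTraj hC)]
  rfl

lemma invariant_bind {μ : Measure E} (hμ : IsInvariantMeasure P μ) : μ.bind P = μ := by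
  ext A hA
  rw [Measure.bind_apply hA P.measurable.aemeasurable, hμ A hA]

lemma variance_aux (ν : Measure E) [IsProbabilityMeasure ν] (g : E → ℝ≥0∞) (hg : Measurable g)
    (hg1 : ∀ x, g x ≤ 1) (c : ℝ≥0∞) (hc : c = ∫⁻ x, g x ∂ν) :
    c ^ 2 ≤ ∫⁻ x, g x ^ 2 ∂ν ∧ (∫⁻ x, g x ^ 2 ∂ν = c ^ 2 → ∀ᵐ x ∂ν, g x = c) := by
  have hc1 : c ≤ 1 := by
    rw [hc]
    calc ∫⁻ x, g x ∂ν ≤ ∫⁻ _, 1 ∂ν := lintegral_mono hg1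
      _ = 1 := by simp
  have hgt : ∀ x, g x ≠ ∞ := fun x => ne_top_of_le_ne_top ENNReal.one_ne_top (hg1 x)
  have hct : c ≠ ∞ := ne_top_of_le_ne_top ENNReal.one_ne_top hc1
  have ha1 : ∫⁻ x, g x ^ 2 ∂ν ≤ 1 := by
    calc ∫⁻ x, g x ^ 2 ∂ν ≤ ∫⁻ _, 1 ∂ν := lintegral_mono fun x => pow_le_one' (hg1 x) 2
      _ = 1 := by simp
  have hat : ∫⁻ x, g x ^ 2 ∂ν ≠ ∞ := ne_top_of_le_ne_top ENNReal.one_ne_top ha1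
  have hr : ∀ x, (g x).toReal ≤ 1 := fun x => by
    simpa using ENNReal.toReal_mono ENNReal.one_ne_top (hg1 x)
  have hm : Measurable fun x => (g x).toReal := hg.ennreal_toReal
  have hi1 : Integrable (fun x => (g x).toReal) ν :=
    Integrable.of_bound hm.aestronglyMeasurable 1 (ae_of_all _ fun x => by
      rw [Real.norm_of_nonneg ENNReal.toReal_nonneg]; exact hr x)
  have hi2 : Integrable (fun x => (g x).toReal ^ 2) ν :=
    Integrable.of_bound (hm.pow_const 2).aestronglyMeasurable 1 (ae_of_all _ fun x => by
      rw [Real.norm_of_nonneg (by positivity)]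
      exact pow_le_one₀ ENNReal.toReal_nonneg (hr x))
  have e1 : ∫ x, (g x).toReal ∂ν = c.toReal := by
    rw [integral_toReal hg.aemeasurable (ae_of_all _ fun x => (hgt x).lt_top), hc]
  have e2 : ∫ x, (g x).toReal ^ 2 ∂ν = (∫⁻ x, g x ^ 2 ∂ν).toReal := by
    rw [← integral_toReal (hg.pow_const 2).aemeasurable
      (ae_of_all _ fun x => (ENNReal.pow_ne_top (hgt x)).lt_top)]
    simp
  have hi3 : Integrable (fun x => ((g x).toReal - c.toReal) ^ 2) ν := by
    have : (fun x => ((g x).toReal - c.toReal) ^ 2) =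
      fun x => (g x).toReal ^ 2 - 2 * c.toReal * (g x).toReal + c.toReal ^ 2 := by
      ext x; ring
    rw [this]
    exact (hi2.sub (hi1.const_mul _)).add (integrable_const _)
  have e3 : ∫ x, ((g x).toReal - c.toReal) ^ 2 ∂ν =
      (∫⁻ x, g x ^ 2 ∂ν).toReal - c.toReal ^ 2 := by
    have : (fun x => ((g x).toReal - c.toReal) ^ 2) =
      fun x => ((g x).toReal ^ 2 - 2 * c.toReal * (g x).toReal) + c.toReal ^ 2 := by
      ext x; ring
    have hi4 : Integrable (fun x => (g x).toReal ^ 2 - 2 * c.toReal * (g x).toReal) ν :=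
      hi2.sub (hi1.const_mul _)
    rw [this, integral_add hi4 (integrable_const _),
      integral_sub hi2 (hi1.const_mul _), integral_const_mul, e1, e2]
    simp
    ring
  constructor
  · rw [← ENNReal.toReal_le_toReal (ENNReal.pow_ne_top hct) hat, ENNReal.toReal_pow]
    have : 0 ≤ ∫ x, ((g x).toReal - c.toReal) ^ 2 ∂ν := integral_nonneg fun x => sq_nonneg _
    linarith
  · intro h
    rw [h, ENNReal.toReal_pow, sub_self, integral_eq_zero_iff_of_nonneg
      (fun x => sq_nonneg _) hi3] at e3
    filter_upwards [e3] with x hx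
    have : (g x).toReal = c.toReal := by
      have : ((g x).toReal - c.toReal) ^ 2 = 0 := hx
      nlinarith [pow_eq_zero_iff (two_ne_zero) |>.1 this]
    exact (ENNReal.toReal_eq_toReal_iff' (hgt x) hct).1 this

lemma zero_one [IsMarkovKernel P] {μ : Measure E} [IsProbabilityMeasure μ]
    (hμ : IsInvariantMeasure P μ) (hℙ : IsChainLaw P ℙP) {G : Set (ℕ → E)}
    (hG : MeasurableSet G) (hinv : shiftTraj ⁻¹' G = G) :
    ∀ᵐ x ∂μ, ℙP x G = 0 ∨ ℙP x G = 1 := by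
  have hK := measurable_chain hℙ
  have hprob := hℙ.1
  have hψm : Measurable fun x => ℙP x G := (Measure.measurable_coe hG).comp hK
  have hharm : ∀ x, ℙP x G = ∫⁻ y, ℙP y G ∂(P x) := fun x => by
    rw [← chain_shift hℙ x hG, hinv]
  have hbind := invariant_bind hμ
  have hv := fun x => variance_aux (P x) (fun y => ℙP y G) hψm (fun y => prob_le_one) _ (hharm x)
  have hae : ∀ᵐ x ∂μ, ∀ᵐ y ∂(P x), ℙP y G = ℙP x G := by
    have h1 : ∫⁻ x, ∫⁻ y, ℙP y G ^ 2 ∂(P x) ∂μ = ∫⁻ x, ℙP x G ^ 2 ∂μ := by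
      rw [← Measure.lintegral_bind P.measurable.aemeasurable (hψm.pow_const 2).aemeasurable, hbind]
    have h2 : ∫⁻ x, ℙP x G ^ 2 ∂μ ≠ ∞ := by
      refine ne_top_of_le_ne_top ENNReal.one_ne_top ?_
      calc ∫⁻ x, ℙP x G ^ 2 ∂μ ≤ ∫⁻ _, 1 ∂μ := lintegral_mono fun x => pow_le_one' prob_le_one 2
        _ = 1 := by simp
    have h3 := ae_eq_of_ae_le_of_lintegral_le (ae_of_all μ fun x => (hv x).1) h2
      (Measurable.lintegral_kernel (hψm.pow_const 2)).aemeasurable h1.le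
    filter_upwards [h3] with x hx
    exact (hv x).2 hx.symm
  have key : ∀ C : Set (ℕ → E), MeasurableSet C →
      ∀ᵐ x ∂μ, ℙP x (C ∩ G) = ℙP x G * ℙP x C := by
    refine MeasurableSpace.induction_on_inter generateFrom_squareCylinders.symm isPi_sq
      ?_ ?_ ?_ ?_
    · simp
    · intro S hS
      obtain ⟨n, t, ht, rfl⟩ := squareCyl_eq_box hS
      clear hS
      induction n generalizing t with
      | zero =>
        have : boxSet 0 t = Set.univ := by ext; simp [boxSet]
        simp [this]
      | succ n ih =>
        have ih' := ih (fun i => t (i + 1)) (fun i => ht (i + 1))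
        rw [← hbind] at ih'
        have ih2 := Measure.ae_ae_of_ae_bind P.measurable.aemeasurable ih'
        filter_upwards [ih2, hae] with x hx hx2
        rw [chain_box hℙ x ht, chain_apply hℙ x ((measurableSet_boxSet _ _ ht).inter hG),
          Set.preimage_inter, cons_preimage_boxSet]
        have : consTraj x ⁻¹' G = G := by
          conv_lhs => rw [← hinv]
          rfl
        rw [this]
        by_cases hx0 : x ∈ t 0
        · simp only [hx0, true_and, Set.indicator_of_mem, Set.ofPred_mem_eq]
          rw [← lintegral_const_mul' _ _ (measure_ne_top _ _)]
          refine lintegral_congr_ae ?_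
          filter_upwards [hx, hx2] with y h1 h2
          rw [h1, h2]
        · simp [hx0]
    · intro C hC h
      filter_upwards [h] with x hx
      have h1 : ℙP x (Cᶜ ∩ G) = ℙP x G - ℙP x (C ∩ G) := by
        rw [← measure_sdiff (Set.inter_subset_right) (hC.inter hG).nullMeasurableSet
          (measure_ne_top _ _)]
        congr 1
        ext ω; simp; tauto
      rw [h1, hx, prob_compl_eq_one_sub hC, ENNReal.mul_sub (fun _ _ => measure_ne_top _ _), mul_one]
    · intro F hd hF h
      filter_upwards [ae_all_iff.2 h] with x hx
      rw [Set.iUnion_inter, measure_iUnion _ (fun i => (hF i).inter hG), measure_iUnion hd hF,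
        ← ENNReal.tsum_mul_left]
      · simp_rw [hx]
      · intro i j hij
        exact (hd hij).mono Set.inter_subset_left Set.inter_subset_left
  filter_upwards [key G hG] with x hx
  rw [Set.inter_self] at hx
  by_cases h0 : ℙP x G = 0
  · exact Or.inl h0
  · right
    have : ℙP x G * ℙP x G = ℙP x G * 1 := by rw [← hx, mul_one]
    exact (ENNReal.mul_right_inj h0 (measure_ne_top _ _)).1 this

/-- The maximal function of Garsia's proof. -/
noncomputable def garsiaMax {Ω : Type*} (T : Ω → Ω) (g : Ω → ℝ) : ℕ → Ω → ℝ
  | 0 => fun _ => 0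
  | n + 1 => fun ω => max 0 (g ω + garsiaMax T g n (T ω))

lemma garsiaMax_nonneg {Ω : Type*} (T : Ω → Ω) (g : Ω → ℝ) (n : ℕ) (ω : Ω) :
    0 ≤ garsiaMax T g n ω := by
  cases n with
  | zero => exact le_rfl
  | succ n => exact le_max_left _ _

lemma garsiaMax_mono {Ω : Type*} (T : Ω → Ω) (g : Ω → ℝ) (n : ℕ) (ω : Ω) :
    garsiaMax T g n ω ≤ garsiaMax T g (n + 1) ω := by
  induction n generalizing ω with
  | zero => exact garsiaMax_nonneg T g 1 ω
  | succ n ih => exact max_le_max le_rfl (add_le_add le_rfl (ih (T ω)))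

lemma garsiaMax_ge {Ω : Type*} (T : Ω → Ω) (g : Ω → ℝ) (n : ℕ) (ω : Ω) :
    ∑ i ∈ Finset.range n, g (T^[i] ω) ≤ garsiaMax T g n ω := by
  induction n generalizing ω with
  | zero => simp [garsiaMax]
  | succ n ih =>
    rw [Finset.sum_range_succ']
    have := ih (T ω)
    have h2 : g ω + garsiaMax T g n (T ω) ≤ garsiaMax T g (n + 1) ω := le_max_right _ _
    simp only [Function.iterate_succ, Function.comp_apply, Function.iterate_zero, id] at this ⊢
    linarith

lemma garsiaMax_le {Ω : Type*} (T : Ω → Ω) (g : Ω → ℝ) (hg : ∀ ω, g ω ≤ 1) (n : ℕ) (ω : Ω) :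
    garsiaMax T g n ω ≤ n := by
  induction n generalizing ω with
  | zero => simp [garsiaMax]
  | succ n ih =>
    have := ih (T ω)
    have := hg ω
    refine max_le (by positivity) ?_
    push_cast
    linarith

lemma garsiaMax_measurable {Ω : Type*} [MeasurableSpace Ω] {T : Ω → Ω} (hT : Measurable T)
    {g : Ω → ℝ} (hg : Measurable g) (n : ℕ) : Measurable (garsiaMax T g n) := by
  induction n with
  | zero => exact measurable_const
  | succ n ih => exact measurable_const.max (hg.add (ih.comp hT))

/-- Maximal ergodic inequality, for functions supported on the set where some
Birkhoff sum is positive. -/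
lemma maximal_ergodic {Ω : Type*} [MeasurableSpace Ω] {Q : Measure Ω} [IsProbabilityMeasure Q]
    {T : Ω → Ω} (hT : MeasurePreserving T Q Q) {g : Ω → ℝ} (hg : Measurable g)
    (hb : ∀ ω, |g ω| ≤ 1)
    (hpos : ∀ ω, g ω = 0 ∨ ∃ n, 0 < ∑ i ∈ Finset.range n, g (T^[i] ω)) :
    0 ≤ ∫ ω, g ω ∂Q := by
  have hg1 : ∀ ω, g ω ≤ 1 := fun ω => (abs_le.1 (hb ω)).2
  have hM := garsiaMax_measurable hT.measurable hg
  have hMi : ∀ n, Integrable (garsiaMax T g n) Q := fun n =>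
    Integrable.of_bound (hM n).aestronglyMeasurable n (ae_of_all _ fun ω => by
      rw [Real.norm_of_nonneg (garsiaMax_nonneg _ _ _ _)]
      exact garsiaMax_le T g hg1 n ω)
  have hMset : ∀ n, MeasurableSet {ω | 0 < garsiaMax T g n ω} := fun n =>
    measurableSet_lt measurable_const (hM n)
  have hgi : Integrable g Q := Integrable.of_bound hg.aestronglyMeasurable 1 (ae_of_all _ hb)
  have hstep : ∀ n, 0 ≤ ∫ ω, {ω | 0 < garsiaMax T g n ω}.indicator g ω ∂Q := by
    intro n
    have hc : ∫ ω, garsiaMax T g n (T ω) ∂Q = ∫ ω, garsiaMax T g n ω ∂Q := by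
      rw [← integral_map hT.measurable.aemeasurable
        (by rw [hT.map_eq]; exact (hM n).aestronglyMeasurable), hT.map_eq]
    have hci : Integrable (fun ω => garsiaMax T g n (T ω)) Q := hT.integrable_comp_of_integrable (hMi n)
    have h0 : ∫ ω, (garsiaMax T g n ω - garsiaMax T g n (T ω)) ∂Q = 0 := by
      rw [integral_sub (hMi n) hci, hc, sub_self]
    refine h0.symm.le.trans ?_
    refine integral_mono ((hMi n).sub hci) (hgi.indicator (hMset n)) fun ω => ?_
    by_cases h : 0 < garsiaMax T g n ω
    · rw [Set.indicator_of_mem (show ω ∈ {ω | 0 < garsiaMax T g n ω} from h)]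
      cases n with
      | zero => exact absurd h (lt_irrefl _)
      | succ n =>
        have h1 : garsiaMax T g (n + 1) ω = g ω + garsiaMax T g n (T ω) := by
          rcases max_choice 0 (g ω + garsiaMax T g n (T ω)) with h2 | h2
          · exact absurd (h.trans_eq h2) (lt_irrefl _)
          · exact h2
        have := garsiaMax_mono T g n (T ω)
        linarith
    · rw [Set.indicator_of_notMem (show ω ∉ {ω | 0 < garsiaMax T g n ω} from h)]
      have := garsiaMax_nonneg T g n (T ω)
      linarith
  have hlim : Tendsto (fun n => ∫ ω, {ω | 0 < garsiaMax T g n ω}.indicator g ω ∂Q) atTop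
      (𝓝 (∫ ω, g ω ∂Q)) := by
    refine tendsto_integral_of_dominated_convergence (fun _ => 1)
      (fun n => (hg.indicator (hMset n)).aestronglyMeasurable) (integrable_const _)
      (fun n => ae_of_all _ fun ω => ?_) (ae_of_all _ fun ω => ?_)
    · exact (norm_indicator_le_norm_self _ _).trans (hb ω)
    · refine tendsto_const_nhds.congr' ?_
      rcases hpos ω with h | ⟨k, hk⟩
      · exact Eventually.of_forall fun n => by simp [Set.indicator, h]
      · filter_upwards [eventually_ge_atTop k] with n hn
        rw [Set.indicator_of_mem]
        exact (hk.trans_le (garsiaMax_ge T g k ω)).trans_le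
          (monotone_nat_of_le_succ (f := fun n => garsiaMax T g n ω)
            (fun n => garsiaMax_mono T g n ω) hn)
  exact ge_of_tendsto' hlim hstep

lemma avg_mem {f : E → ℝ} (hrange : ∀ x, f x ∈ Set.Icc (0 : ℝ) 1) (ω : ℕ → E) (n : ℕ) :
    (∑ i ∈ Finset.range n, f (ω i)) / n ∈ Set.Icc (0 : ℝ) 1 := by
  have h0 : 0 ≤ ∑ i ∈ Finset.range n, f (ω i) := Finset.sum_nonneg fun i _ => (hrange _).1
  have h1 : ∑ i ∈ Finset.range n, f (ω i) ≤ n := by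
    simpa using Finset.sum_le_card_nsmul (Finset.range n) (fun i => f (ω i)) 1
      fun i _ => (hrange _).2
  exact ⟨by positivity, div_le_one_of_le₀ h1 (by positivity)⟩

lemma G_iff {f : E → ℝ} (hrange : ∀ x, f x ∈ Set.Icc (0 : ℝ) 1) (γ : ℝ) (ω : ℕ → E) :
    γ ≤ liminf (fun n : ℕ => (∑ i ∈ Finset.range n, f (ω i)) / n) atTop ↔
      ∀ y < γ, ∀ᶠ n : ℕ in atTop, y < (∑ i ∈ Finset.range n, f (ω i)) / n := by
  refine le_liminf_iff ?_ ?_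
  · exact (isBoundedUnder_of ⟨1, fun n => (avg_mem hrange ω n).2⟩).isCoboundedUnder_ge
  · exact isBoundedUnder_of ⟨0, fun n => (avg_mem hrange ω n).1⟩

lemma G_inv {f : E → ℝ} (hrange : ∀ x, f x ∈ Set.Icc (0 : ℝ) 1) (γ : ℝ) :
    shiftTraj ⁻¹' {ω : ℕ → E |
      γ ≤ liminf (fun n : ℕ => (∑ i ∈ Finset.range n, f (ω i)) / n) atTop} = {ω : ℕ → E |
      γ ≤ liminf (fun n : ℕ => (∑ i ∈ Finset.range n, f (ω i)) / n) atTop} := by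
  ext ω
  simp only [Set.mem_preimage, Set.mem_ofPred_eq, G_iff hrange]
  have hsum : ∀ n, ∑ i ∈ Finset.range (n + 1), f (ω i) =
      ∑ i ∈ Finset.range n, f (shiftTraj ω i) + f (ω 0) := fun n => Finset.sum_range_succ' _ _
  -- the two averages differ by `O(1/n)`
  have hclose : Tendsto (fun n : ℕ => (∑ i ∈ Finset.range (n + 1), f (ω i)) / ((n + 1 : ℕ) : ℝ) -
      (∑ i ∈ Finset.range n, f (shiftTraj ω i)) / n) atTop (𝓝 0) := by
    refine squeeze_zero_norm (a := fun n : ℕ => 1 / ((n : ℝ) + 1)) (fun n => ?_)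
      tendsto_one_div_add_atTop_nhds_zero_nat
    have ha := avg_mem hrange (shiftTraj ω) n
    have hf0 := hrange (ω 0)
    have hn1 : (0 : ℝ) < n + 1 := by positivity
    set A := (∑ i ∈ Finset.range n, f (shiftTraj ω i)) / (n : ℝ) with hA
    have hS : ∑ i ∈ Finset.range n, f (shiftTraj ω i) = n * A := by
      rcases Nat.eq_zero_or_pos n with h | h
      · subst h; simp
      · rw [hA]; field_simp
    rw [hsum, hS]
    have : (n * A + f (ω 0)) / ((n + 1 : ℕ) : ℝ) - A = (f (ω 0) - A) / (n + 1) := by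
      push_cast; field_simp; ring
    rw [this, Real.norm_eq_abs, abs_div, abs_of_pos hn1]
    gcongr
    exact abs_le.2 ⟨by linarith [ha.2, hf0.1], by linarith [ha.1, hf0.2]⟩
  constructor
  · intro h y hy
    obtain ⟨z, hyz, hz⟩ := exists_between hy
    rw [← map_add_atTop_eq_nat 1, eventually_map]
    filter_upwards [h z hz, hclose.eventually (lt_mem_nhds (show y - z < 0 by linarith))]
      with n h1 h2
    linarith
  · intro h y hy
    obtain ⟨z, hyz, hz⟩ := exists_between hy
    have h3 := (tendsto_add_atTop_nat 1).eventually (h z hz)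
    filter_upwards [h3, hclose.eventually (gt_mem_nhds (show 0 < z - y by linarith))]
      with n h1 h2
    linarith

end Aux

/-- Proposition `psi`, second part: if `f : E → [0,1]` is measurable,
`m = ∫ f dμ` and `γ ∈ [0, m]` with `γ < 1`, then
`μ({x : ψ_γ(x) = 1}) ≥ 1 - (1-m)/(1-γ)`, where
`ψ_γ(x) = ℙ_x(liminf (1/n) ∑_{i<n} f(X_i) ≥ γ)`. -/
theorem measure_psi_gamma_eq_one_lower_bound
    {E : Type*} [MeasurableSpace E] (P : Kernel E E) [IsMarkovKernel P]
    (μ : Measure E) [IsProbabilityMeasure μ] (hμ : IsInvariantMeasure P μ)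
    (ℙP : E → Measure (ℕ → E)) (hℙ : IsChainLaw P ℙP)
    (f : E → ℝ) (hf : Measurable f) (hrange : ∀ x, f x ∈ Set.Icc (0 : ℝ) 1)
    (m : ℝ) (hm : m = ∫ x, f x ∂μ)
    (γ : ℝ) (hγ : γ ∈ Set.Icc 0 m) (hγ1 : γ < 1)
    (ψ : E → ENNReal)
    (hψ : ∀ x, ψ x = ℙP x {ω : ℕ → E |
      γ ≤ liminf (fun n : ℕ => (∑ i ∈ Finset.range n, f (ω i)) / n) atTop}) :
    ENNReal.ofReal (1 - (1 - m) / (1 - γ)) ≤ μ {x : E | ψ x = 1} := by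
  have hK := measurable_chain hℙ
  have hprob := hℙ.1
  have hbind := invariant_bind hμ
  set G : Set (ℕ → E) := {ω : ℕ → E |
      γ ≤ liminf (fun n : ℕ => (∑ i ∈ Finset.range n, f (ω i)) / n) atTop} with hGdef
  have hG : MeasurableSet G := by
    refine measurableSet_le measurable_const (Measurable.liminf fun n => ?_)
    exact (Finset.measurable_sum _ fun i _ => hf.comp (measurable_pi_apply i)).div_const _
  have hinv : shiftTraj ⁻¹' G = G := G_inv hrange γ
  have h01 := zero_one hμ hℙ hG hinv
  set Q : Measure (ℕ → E) := μ.bind ℙP with hQ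
  have hQa : ∀ C, MeasurableSet C → Q C = ∫⁻ x, ℙP x C ∂μ := fun C hC =>
    Measure.bind_apply hC hK.aemeasurable
  have hQp : IsProbabilityMeasure Q := ⟨by rw [hQa _ MeasurableSet.univ]; simp⟩
  have hT : MeasurePreserving (shiftTraj : (ℕ → E) → ℕ → E) Q Q := by
    refine ⟨measurable_shiftTraj, ?_⟩
    ext C hC
    rw [Measure.map_apply measurable_shiftTraj hC, hQa _ (measurable_shiftTraj hC), hQa _ hC]
    simp_rw [chain_shift hℙ _ hC]
    have hm' : Measurable fun y => ℙP y C := (Measure.measurable_coe hC).comp hK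
    rw [← Measure.lintegral_bind P.measurable.aemeasurable hm'.aemeasurable, hbind]
  have hQ0 : Q.map (fun ω => ω 0) = μ := by
    ext A hA
    rw [Measure.map_apply (measurable_pi_apply 0) hA, hQa _ (measurable_pi_apply 0 hA),
      ← lintegral_indicator_one hA]
    refine lintegral_congr fun x => ?_
    rw [chain_apply hℙ x (measurable_pi_apply 0 hA)]
    have : consTraj x ⁻¹' ((fun ω : ℕ → E => ω 0) ⁻¹' A) = {_ω | x ∈ A} := rfl
    rw [this]
    by_cases hx : x ∈ A <;> simp [hx]
  have hf0 : Measurable fun ω : ℕ → E => f (ω 0) := hf.comp (measurable_pi_apply 0)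
  have hmQ : m = ∫ ω, f (ω 0) ∂Q := by
    rw [hm, ← hQ0, integral_map (measurable_pi_apply 0).aemeasurable hf.aestronglyMeasurable]
  set g : (ℕ → E) → ℝ := Gᶜ.indicator (fun ω => γ - f (ω 0)) with hg
  have hgm : Measurable g := (measurable_const.sub hf0).indicator hG.compl
  have hgb : ∀ ω, |g ω| ≤ 1 := by
    intro ω
    by_cases h : ω ∈ Gᶜ
    · rw [hg, Set.indicator_of_mem h]
      have := hrange (ω 0)
      exact abs_le.2 ⟨by linarith [this.2, hγ.1], by linarith [this.1]⟩
    · rw [hg, Set.indicator_of_notMem h]; simp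
  have hmem : ∀ (i : ℕ) (ω : ℕ → E), shiftTraj^[i] ω ∈ G ↔ ω ∈ G := by
    intro i
    induction i with
    | zero => intro ω; rfl
    | succ i ih =>
      intro ω
      rw [Function.iterate_succ, Function.comp_apply, ih]
      exact Set.ext_iff.1 hinv ω
  have hiter : ∀ (i : ℕ) (ω : ℕ → E) (k : ℕ), shiftTraj^[i] ω k = ω (k + i) := by
    intro i
    induction i with
    | zero => intro ω k; rfl
    | succ i ih =>
      intro ω k
      rw [Function.iterate_succ, Function.comp_apply, ih]
      rfl
  have hint : 0 ≤ ∫ ω, g ω ∂Q := by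
    refine maximal_ergodic hT hgm hgb fun ω => ?_
    by_cases h : ω ∈ G
    · left; rw [hg, Set.indicator_of_notMem (by simpa using h)]
    · right
      by_contra hcon
      push Not at hcon
      apply h
      rw [hGdef, Set.mem_ofPred_eq, G_iff hrange]
      intro y hy
      filter_upwards [eventually_gt_atTop 0] with n hn
      refine hy.trans_le ?_
      have h1 := hcon n
      have h2 : ∑ i ∈ Finset.range n, g (shiftTraj^[i] ω) =
          n * γ - ∑ i ∈ Finset.range n, f (ω i) := by
        rw [Finset.sum_congr rfl (g := fun i => γ - f (ω i))]
        · simp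
        · intro i _
          rw [hg, Set.indicator_of_mem (by rw [Set.mem_compl_iff, hmem]; exact h), hiter, zero_add]
      rw [h2] at h1
      rw [le_div_iff₀ (by exact_mod_cast hn)]
      linarith
  have hgi : Integrable g Q := Integrable.of_bound hgm.aestronglyMeasurable 1 (ae_of_all _ hgb)
  have hGi : Integrable (G.indicator (fun _ => 1 - γ)) Q := (integrable_const _).indicator hG
  have hmain : m ≤ γ + (1 - γ) * Q.real G := by
    have h1 : ∫ ω, f (ω 0) ∂Q ≤ ∫ ω, ((γ - g ω) + G.indicator (fun _ => 1 - γ) ω) ∂Q := by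
      refine integral_mono_of_nonneg (ae_of_all _ fun ω => (hrange _).1)
        (((integrable_const _).sub hgi).add hGi) (ae_of_all _ fun ω => ?_)
      have := hrange (ω 0)
      by_cases h : ω ∈ G
      · simp [hg, h, this.2]
      · simp [hg, h]
    have hi' : Integrable (fun ω => γ - g ω) Q := (integrable_const _).sub hgi
    rw [integral_add hi' hGi, integral_sub (integrable_const _) hgi,
      integral_indicator_const _ hG, ← hmQ] at h1
    simp at h1
    linarith
  have hQG : Q G = μ {x : E | ψ x = 1} := by
    have hψm : Measurable ψ := by
      have : ψ = fun x => ℙP x G := funext hψ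
      rw [this]
      exact (Measure.measurable_coe hG).comp hK
    have hset : MeasurableSet {x : E | ψ x = 1} := hψm (measurableSet_singleton 1)
    rw [hQa _ hG, ← lintegral_indicator_one hset]
    refine lintegral_congr_ae ?_
    filter_upwards [h01] with x hx
    rcases hx with hx | hx
    · rw [Set.indicator_of_notMem (by simp [hψ, hx]), hx]
    · rw [Set.indicator_of_mem (by simp [hψ, hx]), hx]; rfl
  rw [← hQG]
  refine ENNReal.ofReal_le_of_le_toReal ?_
  change _ ≤ Q.real G
  have h1 : (0 : ℝ) < 1 - γ := by linarith
  rw [sub_le_iff_le_add, ← sub_le_iff_le_add', le_div_iff₀ h1]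
  nlinarith
end
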